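/- arXiv:2605.16142 — 6 statements merged into one kernel-verified Lean document; each statement's English description precedes it below -/
import Mathlib

section
/- Let S be a finite type of states with a successor relation succ : S → S → Prop, an initial state s0 and a goal predicate. Let h : S → ℝ be a heuristic that is descending and dead-end avoiding. If s0 is alive, then there exists a natural number n and a finite sequence of states t_0, t_1, …, t_n with t_0 = s0, such that each consecutive pair (t_i, t_{i+1}) is an improving step and t_n is a goal state. (Hill climbing guided by a descending, dead-end avoiding heuristic reaches the goal from the initial state.) -/
/-- A state `s` is reachable from `s0` via the successor relation. -/
def Reachable {S : Type*} (succ : S → S → Prop) (s0 s : S) : Prop :=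
  Relation.ReflTransGen succ s0 s

/-- A state `s` is solvable: some goal state is reachable from it. -/
def Solvable {S : Type*} (succ : S → S → Prop) (goal : S → Prop) (s : S) : Prop :=
  ∃ g, goal g ∧ Relation.ReflTransGen succ s g

/-- A state is alive if it is reachable, solvable, and not a goal. -/
def Alive {S : Type*} (succ : S → S → Prop) (s0 : S) (goal : S → Prop) (s : S) : Prop :=
  Reachable succ s0 s ∧ Solvable succ goal s ∧ ¬ goal s

/-- An improving step from `s` to `s'`: `s'` is a successor with strictly smaller heuristic. -/
def Improving {S : Type*} (succ : S → S → Prop) (h : S → ℝ) (s s' : S) : Prop :=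
  succ s s' ∧ h s' < h s

/-- `h` is descending: every alive state has an improving successor. -/
def Descending {S : Type*} (succ : S → S → Prop) (s0 : S) (goal : S → Prop) (h : S → ℝ) : Prop :=
  ∀ s, Alive succ s0 goal s → ∃ s', Improving succ h s s'

/-- `h` is dead-end avoiding: every improving successor of an alive state is solvable. -/
def DeadEndAvoiding {S : Type*} (succ : S → S → Prop) (s0 : S) (goal : S → Prop)
    (h : S → ℝ) : Prop :=
  ∀ s s', Alive succ s0 goal s → Improving succ h s s' → Solvable succ goal s'

/-- `S↓`: the set of alive states reachable from `s0` via improving steps. -/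
def SDown {S : Type*} (succ : S → S → Prop) (s0 : S) (goal : S → Prop) (h : S → ℝ) : Set S :=
  {s | Alive succ s0 goal s ∧ Relation.ReflTransGen (Improving succ h) s0 s}

/-- `h` is direct: every state in `S↓` has an improving successor, and every improving
successor of a state in `S↓` is a goal state or belongs to `S↓`. -/
def Direct {S : Type*} (succ : S → S → Prop) (s0 : S) (goal : S → Prop) (h : S → ℝ) : Prop :=
  (∀ s ∈ SDown succ s0 goal h, ∃ s', Improving succ h s s') ∧
  (∀ s ∈ SDown succ s0 goal h, ∀ s', Improving succ h s s' →
    goal s' ∨ s' ∈ SDown succ s0 goal h)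

/-- Hill climbing guided by a descending, dead-end avoiding heuristic reaches the goal
from the initial state. -/
theorem descending_dda_reaches_goal {S : Type*} [Fintype S]
    (succ : S → S → Prop) (s0 : S) (goal : S → Prop) (h : S → ℝ)
    (hdesc : Descending succ s0 goal h) (hdda : DeadEndAvoiding succ s0 goal h)
    (halive : Alive succ s0 goal s0) :
    ∃ (n : ℕ) (t : ℕ → S), t 0 = s0 ∧
      (∀ i < n, Improving succ h (t i) (t (i + 1))) ∧ goal (t n) := by
  have key : ∀ s, Alive succ s0 goal s → ∃ (n : ℕ) (t : ℕ → S), t 0 = s ∧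
      (∀ i < n, Improving succ h (t i) (t (i + 1))) ∧ goal (t n) := by
    let r : S → S → Prop := fun a b => h a < h b
    haveI : IsTrans S r := ⟨fun _ _ _ hab hbc => lt_trans hab hbc⟩
    haveI : Std.Irrefl r := ⟨fun a => lt_irrefl (h a)⟩
    have wf : WellFounded r := Finite.wellFounded_of_trans_of_irrefl r
    intro s
    induction s using wf.induction with
    | _ s ih =>
      intro hs
      obtain ⟨s', hi⟩ := hdesc s hs
      by_cases hg : goal s'
      · refine ⟨1, fun i => if i = 0 then s else s', by simp, ?_, by simpa using hg⟩
        intro i hlt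
        obtain rfl : i = 0 := by omega
        simpa using hi
      · obtain ⟨n, t, h0, hstep, hgoal⟩ := ih s' hi.2
          ⟨Relation.ReflTransGen.tail hs.1 hi.1, hdda s s' hs hi, hg⟩
        refine ⟨n + 1, fun i => Nat.casesOn i s t, rfl, ?_, hgoal⟩
        intro i hlt
        cases i with
        | zero => simpa [h0] using hi
        | succ k => exact hstep k (by omega)
  exact key s0 halive
end

section
/- Let S be a finite type of states with a successor relation succ : S → S → Prop, an initial state s0 and a goal predicate, and let h : S → ℝ be descending and dead-end avoiding. Then from every alive state s there exists a finite sequence of improving steps starting at s and ending at a goal state. -/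
/-- From every alive state there is a finite sequence of improving steps ending at a goal. -/
theorem alive_improving_path_to_goal {S : Type*} [Fintype S]
    (succ : S → S → Prop) (s0 : S) (goal : S → Prop) (h : S → ℝ)
    (hdesc : Descending succ s0 goal h) (hdda : DeadEndAvoiding succ s0 goal h) :
    ∀ s, Alive succ s0 goal s →
      ∃ (n : ℕ) (t : ℕ → S), t 0 = s ∧
        (∀ i < n, Improving succ h (t i) (t (i + 1))) ∧ goal (t n) := by
  have wf : WellFounded (fun a b : S => h a < h b) := by
    haveI : IsTrans S (fun a b : S => h a < h b) := ⟨fun _ _ _ h1 h2 => lt_trans h1 h2⟩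
    haveI : Std.Irrefl (fun a b : S => h a < h b) := ⟨fun _ => lt_irrefl _⟩
    exact Finite.wellFounded_of_trans_of_irrefl _
  intro s
  induction s using wf.induction with
  | _ s ih =>
    intro hs
    obtain ⟨s', hi⟩ := hdesc s hs
    by_cases hg : goal s'
    · refine ⟨1, fun i => if i = 0 then s else s', by simp, ?_, by simpa using hg⟩
      intro i hlt
      obtain rfl : i = 0 := by omega
      simpa using hi
    · obtain ⟨n, t, h0, hstep, hgoal⟩ := ih s' hi.2
        ⟨Relation.ReflTransGen.tail hs.1 hi.1, hdda s s' hs hi, hg⟩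
      refine ⟨n + 1, fun i => Nat.casesOn i s t, rfl, ?_, hgoal⟩
      intro i hlt
      cases i with
      | zero =>
        change Improving succ h s (t 0)
        rw [h0]
        exact hi
      | succ k => exact hstep k (by omega)
end

section
/- Let S be a finite type of states with a successor relation succ, an initial state s0 and a goal predicate, and let h : S → ℝ be a direct heuristic. If s0 is alive, then there exists n ≤ Fintype.card S − 1 and a finite sequence of states t_0, t_1, …, t_n with t_0 = s0, such that each consecutive pair (t_i, t_{i+1}) is an improving step and t_n is a goal state. (Hill climbing guided by a direct heuristic reaches a goal state from the initial state without ever getting stuck, in at most |S| − 1 steps.) -/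
/-- Hill climbing guided by a direct heuristic reaches a goal state from the initial state
in at most `Fintype.card S - 1` improving steps. -/
theorem direct_reaches_goal_bounded {S : Type*} [Fintype S]
    (succ : S → S → Prop) (s0 : S) (goal : S → Prop) (h : S → ℝ)
    (hdir : Direct succ s0 goal h) (halive : Alive succ s0 goal s0) :
    ∃ n ≤ Fintype.card S - 1, ∃ t : ℕ → S, t 0 = s0 ∧
      (∀ i < n, Improving succ h (t i) (t (i + 1))) ∧ goal (t n) := by
  classical
  have key : ∀ k : ℕ, ∀ s ∈ SDown succ s0 goal h,
      (Finset.univ.filter (fun x => h x < h s)).card ≤ k →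
      ∃ n ≤ k, ∃ t : ℕ → S, t 0 = s ∧
        (∀ i < n, Improving succ h (t i) (t (i + 1))) ∧ goal (t n) := by
    intro k
    induction k with
    | zero =>
      intro s hs hk
      obtain ⟨s', h'⟩ := hdir.1 s hs
      have hm : s' ∈ Finset.univ.filter (fun x => h x < h s) := by simpa using h'.2
      have := Finset.card_pos.mpr ⟨s', hm⟩
      omega
    | succ k ih =>
      intro s hs hk
      obtain ⟨s', h'⟩ := hdir.1 s hs
      rcases hdir.2 s hs s' h' with hg | hd
      · refine ⟨1, by omega, fun i => Nat.casesOn i s (fun _ => s'), rfl, ?_, hg⟩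
        intro i hi
        obtain rfl : i = 0 := by omega
        exact h'
      · have hlt : (Finset.univ.filter (fun x => h x < h s')).card <
            (Finset.univ.filter (fun x => h x < h s)).card := by
          apply Finset.card_lt_card
          rw [Finset.ssubset_iff_of_subset]
          · exact ⟨s', by simpa using h'.2, by simp⟩
          · intro x hx
            simp only [Finset.mem_filter, Finset.mem_univ, true_and] at hx ⊢
            exact hx.trans h'.2
        obtain ⟨n, hn, t, ht0, ht, hg⟩ := ih s' hd (by omega)
        refine ⟨n + 1, by omega, fun i => Nat.casesOn i s t, rfl, ?_, hg⟩
        intro i hi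
        cases i with
        | zero =>
          change Improving succ h s (t 0)
          rw [ht0]
          exact h'
        | succ j => exact ht j (by omega)
  refine key _ s0 ⟨halive, Relation.ReflTransGen.refl⟩ ?_
  have hlt : (Finset.univ.filter (fun x => h x < h s0)).card < Fintype.card S :=
    Finset.card_lt_univ_of_notMem (x := s0) (by simp)
  omega
end

section
/- Let S be a finite type of states with a successor relation succ, an initial state s0 and a goal predicate, and let h : S → ℝ be a direct heuristic. Then from every state s ∈ S↓ there exists a finite sequence of improving steps starting at s and ending at a goal state. -/
/-- For a direct heuristic, from every state in `S↓` there is a finite sequence of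
improving steps ending at a goal state. -/
theorem direct_sdown_path_to_goal {S : Type*} [Fintype S]
    (succ : S → S → Prop) (s0 : S) (goal : S → Prop) (h : S → ℝ)
    (hdir : Direct succ s0 goal h) :
    ∀ s ∈ SDown succ s0 goal h,
      ∃ (n : ℕ) (t : ℕ → S), t 0 = s ∧
        (∀ i < n, Improving succ h (t i) (t (i + 1))) ∧ goal (t n) := by
  have wf : WellFounded (fun a b : S => h a < h b) := by
    haveI : IsTrans S (fun a b : S => h a < h b) := ⟨fun _ _ _ h1 h2 => lt_trans h1 h2⟩
    haveI : Std.Irrefl (fun a b : S => h a < h b) := ⟨fun _ h1 => lt_irrefl _ h1⟩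
    exact Finite.wellFounded_of_trans_of_irrefl _
  intro s
  induction s using wf.induction with
  | _ s ih =>
    intro hs
    obtain ⟨s', hi⟩ := hdir.1 s hs
    have key : ∃ (n : ℕ) (t : ℕ → S), t 0 = s' ∧
        (∀ i < n, Improving succ h (t i) (t (i + 1))) ∧ goal (t n) := by
      rcases hdir.2 s hs s' hi with hg | hd
      · exact ⟨0, fun _ => s', rfl, fun i hi => absurd hi (Nat.not_lt_zero i), hg⟩
      · exact ih s' hi.2 hd
    obtain ⟨n, t, h0, hstep, hg⟩ := key
    refine ⟨n + 1, fun i => Nat.casesOn i s t, rfl, ?_, hg⟩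
    intro i hin
    cases i with
    | zero =>
      show Improving succ h s (t 0)
      rw [h0]
      exact hi
    | succ k => exact hstep k (by omega)
end

section
/- There exist a finite type S of states, a successor relation succ : S → S → Prop, an initial state s0, a goal predicate, and a heuristic h : S → ℝ such that h is direct but not descending, i.e., some alive state has no improving successor. (Directness is a strict relaxation of the descending property.) -/
/-- There is a transition system and a heuristic that is direct but not descending:
some alive state has no improving successor. -/
theorem exists_direct_not_descending :
    ∃ (S : Type) (_ : Fintype S) (succ : S → S → Prop) (s0 : S)
      (goal : S → Prop) (h : S → ℝ),
      Direct succ s0 goal h ∧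
      ∃ s, Alive succ s0 goal s ∧ ¬ ∃ s', Improving succ h s s' := by
  let succ : Fin 3 → Fin 3 → Prop := fun a b => a = 0 ∨ (a = 1 ∧ b = 0)
  let h : Fin 3 → ℝ := fun a => if a = 2 then 0 else 1
  have himp : ∀ a b, Improving succ h a b → a = 0 ∧ b = 2 := by
    rintro a b ⟨h1, h2⟩
    have hb : b = 2 := by
      by_contra hb
      simp only [h, if_neg hb] at h2
      split_ifs at h2 <;> linarith
    subst hb
    rcases h1 with h1 | ⟨_, h1⟩
    · exact ⟨h1, rfl⟩
    · exact absurd h1 (by decide)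
  refine ⟨Fin 3, inferInstance, succ, 0, fun a => a = 2, h, ⟨?_, ?_⟩, 1, ⟨?_, ?_, by decide⟩, ?_⟩
  · rintro s ⟨⟨_, _, hg⟩, hr⟩
    have hs : s = 0 := by
      rcases Relation.ReflTransGen.cases_tail hr with h0 | ⟨c, _, hc⟩
      · exact h0
      · exact absurd (himp _ _ hc).2 hg
    subst hs
    exact ⟨2, Or.inl rfl, by simp [h]⟩
  · intro s _ s' hi
    exact Or.inl (himp _ _ hi).2
  · exact Relation.ReflTransGen.single (Or.inl rfl)
  · have h1 : succ 1 0 := Or.inr ⟨rfl, rfl⟩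
    have h2 : succ 0 2 := Or.inl rfl
    exact ⟨2, rfl, (Relation.ReflTransGen.single h1).tail h2⟩
  · rintro ⟨s', hi⟩
    exact absurd (himp _ _ hi).1 (by decide)
end

section
/- Let S be a finite type of states with a successor relation succ, an initial state s0 and a goal predicate. If there exists a direct heuristic h : S → ℝ and s0 is alive, then s0 is solvable with a plan of bounded length: there is a sequence of at most Fintype.card S − 1 succ-steps from s0 to a goal state. (Any direct heuristic guides hill climbing to a goal, so directness certifies solvability.) -/
open Classical in
theorem direct_aux {S : Type*} [Fintype S]
    (succ : S → S → Prop) (s0 : S) (goal : S → Prop) (h : S → ℝ)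
    (hd : Direct succ s0 goal h) (k : ℕ) :
    ∀ s ∈ SDown succ s0 goal h, (Finset.univ.filter (fun x => h x < h s)).card ≤ k →
    ∃ n ≤ k, ∃ t : ℕ → S, t 0 = s ∧
      (∀ i < n, succ (t i) (t (i + 1))) ∧ goal (t n) := by
  induction k with
  | zero =>
    intro s hs hk
    obtain ⟨s', h1, h2⟩ := hd.1 s hs
    have : s' ∈ Finset.univ.filter (fun x => h x < h s) := by simp [h2]
    have := Finset.card_pos.mpr ⟨s', this⟩
    omega
  | succ k ih =>
    intro s hs hk
    obtain ⟨s', h1, h2⟩ := hd.1 s hs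
    rcases hd.2 s hs s' ⟨h1, h2⟩ with hg | hs'
    · refine ⟨1, by omega, fun i => if i = 0 then s else s', by simp, ?_, by simpa using hg⟩
      intro i hi
      obtain rfl : i = 0 := by omega
      simpa using h1
    · have hlt : (Finset.univ.filter (fun x => h x < h s')).card <
          (Finset.univ.filter (fun x => h x < h s)).card := by
        apply Finset.card_lt_card
        rw [Finset.ssubset_iff_of_subset]
        · exact ⟨s', by simp [h2], by simp⟩
        · intro x hx
          simp only [Finset.mem_filter, Finset.mem_univ, true_and] at hx ⊢
          exact hx.trans h2
      obtain ⟨n, hn, t, ht0, hts, htg⟩ := ih s' hs' (by omega)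
      refine ⟨n + 1, by omega, fun i => Nat.casesOn i s t, rfl, ?_, htg⟩
      intro i hi
      cases i with
      | zero => simpa [ht0] using h1
      | succ j => exact hts j (by omega)

/-- If a direct heuristic exists and `s0` is alive, then `s0` is solvable with a plan of
at most `Fintype.card S - 1` `succ`-steps. -/
theorem direct_certifies_solvability {S : Type*} [Fintype S]
    (succ : S → S → Prop) (s0 : S) (goal : S → Prop)
    (hdir : ∃ h : S → ℝ, Direct succ s0 goal h)
    (halive : Alive succ s0 goal s0) :
    ∃ n ≤ Fintype.card S - 1, ∃ t : ℕ → S, t 0 = s0 ∧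
      (∀ i < n, succ (t i) (t (i + 1))) ∧ goal (t n) := by
  classical
  obtain ⟨h, hd⟩ := hdir
  refine direct_aux succ s0 goal h hd _ s0 ⟨halive, Relation.ReflTransGen.refl⟩ ?_
  have : (Finset.univ.filter (fun x => h x < h s0)).card < Fintype.card S := by
    apply Finset.card_lt_card
    rw [Finset.ssubset_iff_of_subset (Finset.subset_univ _)]
    exact ⟨s0, by simp, by simp⟩
  convert Nat.le_sub_one_of_lt this
end
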